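/- arXiv:0908.2399 — 2 statements merged into one kernel-verified Lean document; each statement's English description precedes it below -/
import Mathlib

section
/- With the optimality notion φ = sd^g, for any strategic game, any ℓ ≥ 1 and any player i: (T_N^ℓ)_i = {s_i ∈ S_i | ¬domin^ℓ(s_i)}; consequently (T_N^∞)_i = {s_i ∈ S_i | ¬domin^∞(s_i)}, where domin^∞ := domin^{ℓ̂} with ℓ̂ := Σ_{i∈N} |S_i|. -/
open scoped Classical

/-- The joint strategies of the opponents of player `i`. -/
abbrev Opp {n : ℕ} (S : Fin n → Type) (i : Fin n) := ∀ j, j ≠ i → S j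

/-- A strategic game (with parametrized preferences): for each player `i` and each joint
strategy of the opponents, an irreflexive and transitive strict preference relation on `S i`. -/
structure Game (n : ℕ) (S : Fin n → Type) where
  pref : ∀ i : Fin n, Opp S i → S i → S i → Prop
  irrefl : ∀ (i : Fin n) (sOpp : Opp S i) (si : S i), ¬ pref i sOpp si si
  trans : ∀ (i : Fin n) (sOpp : Opp S i) (a b c : S i),
    pref i sOpp a b → pref i sOpp b c → pref i sOpp a c

variable {n : ℕ} {S : Fin n → Type}

/-- A restriction of the game: a family of subsets of the strategy sets. -/
abbrev Restriction (S : Fin n → Type) := ∀ i, Set (S i)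

/-- The full game, as a restriction. -/
def fullR (S : Fin n → Type) : Restriction S := fun _ => Set.univ

/-- Componentwise inclusion of restrictions. -/
def RestrLE (R R' : Restriction S) : Prop := ∀ i, R i ⊆ R' i

/-- `sOpp` is a joint strategy of the opponents of `i` inside the restriction `R`. -/
def inOpp (R : Restriction S) {i : Fin n} (sOpp : Opp S i) : Prop :=
  ∀ (j : Fin n) (h : j ≠ i), sOpp j h ∈ R j

/-- Global strict dominance optimality: `si` is not strictly dominated on `R` by any strategy
from the *initial* game. -/
def sdg (G : Game n S) (R : Restriction S) (i : Fin n) (si : S i) : Prop :=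
  ¬ ∃ si' : S i, ∀ sOpp : Opp S i, inOpp R sOpp → G.pref i sOpp si' si

/-- Local strict dominance optimality: `si` is not strictly dominated on `R` by any strategy
from the restriction `R i`. -/
def sdl (G : Game n S) (R : Restriction S) (i : Fin n) (si : S i) : Prop :=
  ¬ ∃ si' ∈ R i, ∀ sOpp : Opp S i, inOpp R sOpp → G.pref i sOpp si' si

/-- The restriction `sd^g(G')` whose `i`-th component is `{s_i ∈ S'_i | sd^g(s_i, G')}`. -/
def sdgRes (G : Game n S) (R : Restriction S) : Restriction S :=
  fun i => {si ∈ R i | sdg G R i si}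

/-- The restriction `sd^ℓ(G')` whose `i`-th component is `{s_i ∈ S'_i | sd^ℓ(s_i, G')}`. -/
def sdlRes (G : Game n S) (R : Restriction S) : Restriction S :=
  fun i => {si ∈ R i | sdl G R i si}

/-- The elimination operator `T_A` for global strict dominance. -/
def Tg (G : Game n S) (A : Set (Fin n)) (R : Restriction S) : Restriction S :=
  fun i => if i ∈ A then {si ∈ R i | sdg G R i si} else R i

/-- The elimination operator `T_A` for local strict dominance. -/
def Tl (G : Game n S) (A : Set (Fin n)) (R : Restriction S) : Restriction S :=
  fun i => if i ∈ A then {si ∈ R i | sdl G R i si} else R i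

/-- `k`-fold iteration of an operator on restrictions, starting at the full game. -/
def iter (T : Restriction S → Restriction S) : ℕ → Restriction S
  | 0 => fullR S
  | k + 1 => T (iter T k)

/-- The limit `T^∞` of the iterations of `T` starting at the full game. -/
def limit (T : Restriction S → Restriction S) : Restriction S :=
  fun i => ⋂ k, iter T k i

/-- The outcome `G(H)` of iterated elimination with respect to a hypergraph `H`
(global strict dominance): its `i`-th component is `(T_{{i}}(⋂_{A : i ∈ A ∈ H} T_A^∞))_i`. -/
def outcomeG (G : Game n S) (H : Set (Set (Fin n))) : Restriction S :=
  fun i => Tg G {i} (fun j => ⋂ A ∈ {A : Set (Fin n) | i ∈ A ∧ A ∈ H}, limit (Tg G A) j) i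

/-- The outcome `G(H)` of iterated elimination with respect to a hypergraph `H`
(local strict dominance). -/
def outcomeL (G : Game n S) (H : Set (Set (Fin n))) : Restriction S :=
  fun i => Tl G {i} (fun j => ⋂ A ∈ {A : Set (Fin n) | i ∈ A ∧ A ∈ H}, limit (Tl G A) j) i

/-- `dominSucc G ℓ i si` is the predicate `domin^{ℓ+1}(s_i)` of the paper:
`dominSucc G 0 = domin^1` and `dominSucc G (ℓ+1) = domin^{ℓ+2}`. -/
def dominSucc {n : ℕ} {S : Fin n → Type} (G : Game n S) : ℕ → ∀ i : Fin n, S i → Prop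
  | 0, i, si => ∃ si' : S i, ∀ sOpp : Opp S i, G.pref i sOpp si' si
  | ℓ + 1, i, si => ∃ si' : S i, ∀ sOpp : Opp S i,
      G.pref i sOpp si' si ∨ ∃ j : Fin n, ∃ h : j ≠ i, dominSucc G ℓ j (sOpp j h)

theorem dominSucc_mono (G : Game n S) : ∀ (ℓ : ℕ) (i : Fin n) (si : S i),
    dominSucc G ℓ i si → dominSucc G (ℓ + 1) i si
  | 0, i, si, ⟨t, ht⟩ => ⟨t, fun o => Or.inl (ht o)⟩
  | ℓ + 1, i, si, ⟨t, ht⟩ => ⟨t, fun o => (ht o).imp id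
      (fun ⟨j, h, hd⟩ => ⟨j, h, dominSucc_mono G ℓ j _ hd⟩)⟩

theorem iter_succ_mem (G : Game n S) (k : ℕ) (i : Fin n) (si : S i) :
    si ∈ iter (Tg G Set.univ) (k + 1) i ↔
      si ∈ iter (Tg G Set.univ) k i ∧ sdg G (iter (Tg G Set.univ) k) i si := by
  simp [iter, Tg]

theorem iter_eq_aux (G : Game n S) : ∀ (ℓ : ℕ) (i : Fin n) (si : S i),
    si ∈ iter (Tg G Set.univ) (ℓ + 1) i ↔ ¬ dominSucc G ℓ i si := by
  intro ℓ
  induction ℓ with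
  | zero =>
    intro i si
    rw [iter_succ_mem]
    simp [iter, fullR, sdg, inOpp, dominSucc]
  | succ ℓ ih =>
    intro i si
    rw [iter_succ_mem]
    have key : sdg G (iter (Tg G Set.univ) (ℓ + 1)) i si ↔ ¬ dominSucc G (ℓ + 1) i si := by
      unfold sdg
      rw [dominSucc]
      refine not_congr (exists_congr fun t => forall_congr' fun o => ?_)
      have : inOpp (iter (Tg G Set.univ) (ℓ + 1)) o ↔
          ¬ ∃ j : Fin n, ∃ h : j ≠ i, dominSucc G ℓ j (o j h) := by
        unfold inOpp
        simp only [ih]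
        push Not
        rfl
      rw [this]
      rw [or_comm, or_iff_not_imp_left]
    rw [key, ih]
    have := dominSucc_mono G ℓ i si
    tauto

theorem iter_anti (G : Game n S) (i : Fin n) :
    Antitone (fun k => iter (Tg G Set.univ) k i) :=
  antitone_nat_of_succ_le fun k _ hx => ((iter_succ_mem G k i _).1 hx).1

theorem iter_stab (G : Game n S) [∀ i, Fintype (S i)] (k : ℕ) :
    iter (Tg G Set.univ) (k + 1) = iter (Tg G Set.univ) k ∨
      k + 1 + ∑ j, (iter (Tg G Set.univ) (k + 1) j).ncard ≤ ∑ j, Fintype.card (S j) := by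
  have step : ∀ k, iter (Tg G Set.univ) (k + 1) = iter (Tg G Set.univ) k ∨
      ∑ j, (iter (Tg G Set.univ) (k + 1) j).ncard < ∑ j, (iter (Tg G Set.univ) k j).ncard := by
    intro k
    by_cases h : iter (Tg G Set.univ) (k + 1) = iter (Tg G Set.univ) k
    · exact Or.inl h
    · right
      obtain ⟨j, hj⟩ := Function.ne_iff.1 h
      refine Finset.sum_lt_sum
        (fun j _ => Set.ncard_le_ncard (iter_anti G j (Nat.le_succ k)) (Set.toFinite _))
        ⟨j, Finset.mem_univ _, Set.ncard_lt_ncard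
          (lt_of_le_of_ne (iter_anti G j (Nat.le_succ k)) hj) (Set.toFinite _)⟩
  induction k with
  | zero =>
    rcases step 0 with h | h
    · exact Or.inl h
    · right
      have : ∑ j, (iter (Tg G Set.univ) 0 j).ncard = ∑ j, Fintype.card (S j) := by
        simp [iter, fullR, Set.ncard_univ]
      omega
  | succ k ih =>
    rcases ih with h | h
    · exact Or.inl (congrArg (Tg G Set.univ) h)
    · rcases step (k + 1) with h' | h'
      · exact Or.inl h'
      · right; omega

/-- With `φ = sd^g`, `(T_N^ℓ)_i = {s_i | ¬ domin^ℓ(s_i)}` for all `ℓ ≥ 1`, and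
consequently `(T_N^∞)_i = {s_i | ¬ domin^{ℓ̂}(s_i)}` with `ℓ̂ = Σ_i |S_i|`.
(Here `domin^ℓ = dominSucc G (ℓ-1)`.) -/
theorem iter_TN_eq_not_domin {n : ℕ} {S : Fin n → Type}
    (hn : 1 < n) [∀ i, Fintype (S i)] [∀ i, Nonempty (S i)]
    (G : Game n S) :
    (∀ (ℓ : ℕ) (i : Fin n),
        iter (Tg G (Set.univ : Set (Fin n))) (ℓ + 1) i = {si : S i | ¬ dominSucc G ℓ i si}) ∧
    (∀ i : Fin n,
        limit (Tg G (Set.univ : Set (Fin n))) i =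
          {si : S i | ¬ dominSucc G ((∑ j : Fin n, Fintype.card (S j)) - 1) i si}) := by
  refine ⟨fun ℓ i => Set.ext fun si => iter_eq_aux G ℓ i si, fun i => ?_⟩
  have hpos : 0 < ∑ j : Fin n, Fintype.card (S j) :=
    Finset.sum_pos (fun j _ => Fintype.card_pos) ⟨i, Finset.mem_univ i⟩
  have hst : ∀ L, L = ∑ j : Fin n, Fintype.card (S j) →
      limit (Tg G Set.univ) i = iter (Tg G Set.univ) L i := by
    intro L hL
    have h0 : iter (Tg G Set.univ) (L + 1) = iter (Tg G Set.univ) L := by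
      rcases iter_stab G L with h | h
      · exact h
      · omega
    have h1 : ∀ m, iter (Tg G Set.univ) (L + m) = iter (Tg G Set.univ) L := by
      intro m
      induction m with
      | zero => rfl
      | succ m ih => exact (congrArg (Tg G Set.univ) ih).trans h0
    refine Set.Subset.antisymm (Set.iInter_subset _ L) (Set.subset_iInter fun k => ?_)
    rw [← h1 k]
    exact iter_anti G i (Nat.le_add_left k L)
  rw [hst _ rfl]
  ext si
  have := iter_eq_aux G ((∑ j : Fin n, Fintype.card (S j)) - 1) i si
  rwa [Nat.sub_add_cancel hpos] at this
end

section
/- For any nonempty group A ⊆ N, any formula φ of the positive epistemic language L^+, and any state (V,M): (V,M) ⊨ C_A φ if and only if there is some ordering i_1,…,i_k of the elements of A (a permutation w of A) such that (V,M) ⊨ K_{i_1} K_{i_2} … K_{i_k} φ. -/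
open scoped Classical

variable {n : ℕ} {S : Fin n → Type}

/-- An atomic preference statement of player `pl`: given the joint strategy `opp` of the
opponents, `pl` strictly prefers `better` to `worse`. -/
structure Atom (n : ℕ) (S : Fin n → Type) where
  pl : Fin n
  opp : Opp S pl
  better : S pl
  worse : S pl

/-- The atom holds in the game `G`. -/
def Atom.Holds {n : ℕ} {S : Fin n → Type} (G : Game n S) (a : Atom n S) : Prop :=
  G.pref a.pl a.opp a.better a.worse

/-- A message: a player (`sender`) communicates one of his atomic preference statements
to a group (`grp`). -/
structure Msg (n : ℕ) (S : Fin n → Type) where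
  sender : Fin n
  grp : Set (Fin n)
  atom : Atom n S

/-- Well-formedness of a message w.r.t. the hypergraph `H`: the atom concerns the sender's
own preferences, the sender belongs to the group, and the group is a hyperarc of `H`. -/
def Msg.Wf {n : ℕ} {S : Fin n → Type} (H : Set (Set (Fin n))) (m : Msg n S) : Prop :=
  m.atom.pl = m.sender ∧ m.sender ∈ m.grp ∧ m.grp ∈ H

variable {n : ℕ} {S : Fin n → Type}

/-- Entailment `M↾_A ⊨ s'_i ≻_{s_{-i}} s_i`: there is a chain of messages in `M`, each sent to
a group containing `A`, connecting `si'` to `si` (for the fixed `sOpp`). -/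
def entails (M : Set (Msg n S)) (A : Set (Fin n)) {i : Fin n} (sOpp : Opp S i)
    (si' si : S i) : Prop :=
  Relation.TransGen
    (fun a b : S i => ∃ m ∈ M, A ⊆ m.grp ∧ m.atom = ⟨i, sOpp, a, b⟩) si' si

/-- The intermediate optimality notion `sd^g_{A,M}(s_i, G')`. -/
def sdgAM (G : Game n S) (M : Set (Msg n S)) (A : Set (Fin n)) (R : Restriction S)
    (i : Fin n) (si : S i) : Prop :=
  if A = {i} then
    ¬ ∃ si' : S i, ∀ sOpp : Opp S i, inOpp R sOpp → G.pref i sOpp si' si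
  else
    ¬ ∃ si' : S i, ∀ sOpp : Opp S i, inOpp R sOpp → entails M A sOpp si' si

/-- The intermediate optimality notion `sd^ℓ_{A,M}(s_i, G')` (dominating strategy must lie
in the restriction). -/
def sdlAM (G : Game n S) (M : Set (Msg n S)) (A : Set (Fin n)) (R : Restriction S)
    (i : Fin n) (si : S i) : Prop :=
  if A = {i} then
    ¬ ∃ si' ∈ R i, ∀ sOpp : Opp S i, inOpp R sOpp → G.pref i sOpp si' si
  else
    ¬ ∃ si' ∈ R i, ∀ sOpp : Opp S i, inOpp R sOpp → entails M A sOpp si' si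

/-- The operator `T_{A,M}` (global version). -/
def TgAM (G : Game n S) (M : Set (Msg n S)) (A : Set (Fin n)) (R : Restriction S) :
    Restriction S :=
  fun i => {si ∈ R i | sdgAM G M A R i si}

/-- The operator `T_{A,M}` (local version). -/
def TlAM (G : Game n S) (M : Set (Msg n S)) (A : Set (Fin n)) (R : Restriction S) :
    Restriction S :=
  fun i => {si ∈ R i | sdlAM G M A R i si}

/-- The closure `H̄` of the hypergraph `H` under nonempty intersection. -/
def Hbar (H : Set (Set (Fin n))) : Set (Set (Fin n)) :=
  {B | B.Nonempty ∧ ∃ 𝒜 : Set (Set (Fin n)), 𝒜 ⊆ H ∧ 𝒜.Nonempty ∧ B = ⋂₀ 𝒜}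

/-- The outcome `G(H,M)` of iterated elimination with respect to `H` and an intermediate
state `M` (global version): `G(H,M)_i = (T_{{i},M}(⋂_{A : i ∈ A ∈ H̄} T_{A,M}^∞))_i`. -/
def outcomeGM (G : Game n S) (H : Set (Set (Fin n))) (M : Set (Msg n S)) : Restriction S :=
  fun i => TgAM G M {i}
    (fun j => ⋂ A ∈ {A : Set (Fin n) | i ∈ A ∧ A ∈ Hbar H}, limit (TgAM G M A) j) i

/-- The outcome `G(H,M)` (local version). -/
def outcomeLM (G : Game n S) (H : Set (Set (Fin n))) (M : Set (Msg n S)) : Restriction S :=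
  fun i => TlAM G M {i}
    (fun j => ⋂ A ∈ {A : Set (Fin n) | i ∈ A ∧ A ∈ Hbar H}, limit (TlAM G M A) j) i

/-- The set `M^H` of all truthful messages permitted by `H`. -/
def allMsgs (G : Game n S) (H : Set (Set (Fin n))) : Set (Msg n S) :=
  {m | m.Wf H ∧ m.atom.Holds G}

set_option linter.unusedSectionVars false

/-- The positive epistemic language `L⁺`: atoms, conjunction, disjunction and common
knowledge operators `C_A` (`K_i := C_{{i}}`). -/
inductive Form (n : ℕ) (S : Fin n → Type) where
  | atom : Atom n S → Form n S
  | and : Form n S → Form n S → Form n S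
  | or : Form n S → Form n S → Form n S
  | ck : Set (Fin n) → Form n S → Form n S

variable {n : ℕ} {S : Fin n → Type}

/-- A valuation: a set of atoms whose slices (for fixed player and opponents' joint strategy)
are irreflexive and transitive. -/
def IsValuation (V : Set (Atom n S)) : Prop :=
  ∀ (i : Fin n) (sOpp : Opp S i),
    (∀ s : S i, (⟨i, sOpp, s, s⟩ : Atom n S) ∉ V) ∧
    (∀ a b c : S i, (⟨i, sOpp, a, b⟩ : Atom n S) ∈ V →
      (⟨i, sOpp, b, c⟩ : Atom n S) ∈ V → (⟨i, sOpp, a, c⟩ : Atom n S) ∈ V)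

/-- A state `(V, M)`: a valuation `V` together with a set `M` of well-formed messages
truthful w.r.t. `V`. -/
structure EpState (n : ℕ) (S : Fin n → Type) (H : Set (Set (Fin n))) where
  V : Set (Atom n S)
  M : Set (Msg n S)
  val : IsValuation V
  wf : ∀ m ∈ M, m.Wf H
  truthful : ∀ m ∈ M, m.atom ∈ V

variable {H : Set (Set (Fin n))}

/-- Indistinguishability `~_i` of states for player `i`: same atoms about `i`'s preferences
and same messages addressed to groups containing `i`. -/
def simI (i : Fin n) (s t : EpState n S H) : Prop :=
  {a ∈ s.V | a.pl = i} = {a ∈ t.V | a.pl = i} ∧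
  {m ∈ s.M | i ∈ m.grp} = {m ∈ t.M | i ∈ m.grp}

/-- `~_A`: the transitive closure of `⋃_{i ∈ A} ~_i`. -/
def simA (A : Set (Fin n)) : EpState n S H → EpState n S H → Prop :=
  Relation.TransGen (fun s t => ∃ i ∈ A, simI i s t)

/-- Semantics of `L⁺`. -/
def sat (s : EpState n S H) : Form n S → Prop
  | .atom a => a ∈ s.V
  | .and f g => sat s f ∧ sat s g
  | .or f g => sat s f ∨ sat s g
  | .ck A f => ∀ t : EpState n S H, simA A s t → sat t f

variable [∀ i, Fintype (S i)] [∀ i, Nonempty (S i)]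

/-- An atom that is false in every valuation (by irreflexivity); used as the value of an
empty disjunction. -/
noncomputable def falseAtom (i : Fin n) (si : S i) : Form n S :=
  .atom ⟨i, fun j _ => Classical.arbitrary (S j), si, si⟩

/-- Disjunction of a list of formulas (`dflt` for the empty list). -/
def bigOr (dflt : Form n S) : List (Form n S) → Form n S
  | [] => dflt
  | f :: l => l.foldl Form.or f

/-- Conjunction of a list of formulas (`dflt` for the empty list). -/
def bigAnd (dflt : Form n S) : List (Form n S) → Form n S
  | [] => dflt
  | f :: l => l.foldl Form.and f

/-- A list of all strategies of player `i`. -/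
noncomputable def stratList (i : Fin n) : List (S i) := Finset.univ.toList

/-- A list of all joint strategies of the opponents of `i`. -/
noncomputable def oppList (i : Fin n) : List (Opp S i) :=
  haveI : Fintype (Opp S i) := Fintype.ofFinite _
  Finset.univ.toList

/-- A list of all players different from `i`. -/
noncomputable def othersList (i : Fin n) : List {j : Fin n // j ≠ i} :=
  haveI : Fintype {j : Fin n // j ≠ i} := Fintype.ofFinite _
  Finset.univ.toList

/-- `domF ℓ i si` is the formula `dom^{ℓ+1}(s_i)` of the paper:
`domF 0 = dom^1` and `domF (ℓ+1) = dom^{ℓ+2}`. -/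
noncomputable def domF : ℕ → ∀ i : Fin n, S i → Form n S
  | 0, i, si =>
      .ck {i} (bigOr (falseAtom i si) ((stratList i).map fun si' =>
        bigAnd (falseAtom i si) ((oppList i).map fun sOpp =>
          .atom ⟨i, sOpp, si', si⟩)))
  | ℓ + 1, i, si =>
      .ck {i} (bigOr (falseAtom i si) ((stratList i).map fun si' =>
        bigAnd (falseAtom i si) ((oppList i).map fun sOpp =>
          bigOr (falseAtom i si)
            (Form.atom ⟨i, sOpp, si', si⟩ ::
              (othersList i).map fun j => domF ℓ j.1 (sOpp j.1 j.2)))))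

/-- The valuation induced by a game is indeed a valuation. -/
theorem isValuation_induced (G : Game n S) : IsValuation {a : Atom n S | a.Holds G} := by
  intro i sOpp
  constructor
  · intro s hs
    exact G.irrefl i sOpp s hs
  · intro a b c hab hbc
    exact G.trans i sOpp a b c hab hbc

/-- The state `(V, M)` where `V` is the valuation induced by the game `G`. -/
noncomputable def stateOf (G : Game n S) (H : Set (Set (Fin n))) (M : Set (Msg n S))
    (hwf : ∀ m ∈ M, m.Wf H) (htruth : ∀ m ∈ M, m.atom.Holds G) : EpState n S H :=
  ⟨{a | a.Holds G}, M, isValuation_induced G, hwf, htruth⟩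

/-- Atoms generated by messages under transitivity. -/
inductive GenAtom {n : ℕ} {S : Fin n → Type} (M : Set (Msg n S)) : Atom n S → Prop
  | base (m : Msg n S) (hm : m ∈ M) : GenAtom M m.atom
  | step (i : Fin n) (o : Opp S i) (a b c : S i) :
      GenAtom M ⟨i, o, a, b⟩ → GenAtom M ⟨i, o, b, c⟩ → GenAtom M ⟨i, o, a, c⟩

theorem GenAtom.sub {n : ℕ} {S : Fin n → Type} {M : Set (Msg n S)} {V : Set (Atom n S)}
    (hV : IsValuation V) (h : ∀ m ∈ M, m.atom ∈ V) {a : Atom n S} (ha : GenAtom M a) :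
    a ∈ V := by
  induction ha with
  | base m hm => exact h m hm
  | step i o a b c _ _ h1 h2 => exact (hV i o).2 a b c h1 h2

theorem GenAtom.vis {n : ℕ} {S : Fin n → Type} {H : Set (Set (Fin n))} {M : Set (Msg n S)}
    (hw : ∀ m ∈ M, m.Wf H) {a : Atom n S} (ha : GenAtom M a) :
    GenAtom {m ∈ M | a.pl ∈ m.grp} a := by
  induction ha with
  | base m hm =>
    refine GenAtom.base m ⟨hm, ?_⟩
    rw [(hw m hm).1]
    exact (hw m hm).2.1
  | step i o a b c _ _ h1 h2 => exact GenAtom.step i o a b c h1 h2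

/-- The least state indistinguishable from `s` for `i`. -/
def minSt {n : ℕ} {S : Fin n → Type} {H : Set (Set (Fin n))} (i : Fin n)
    (s : EpState n S H) : EpState n S H where
  V := {a | (a ∈ s.V ∧ a.pl = i) ∨ GenAtom {m ∈ s.M | i ∈ m.grp} a}
  M := {m ∈ s.M | i ∈ m.grp}
  val := by
    have key : ∀ a, ((a ∈ s.V ∧ a.pl = i) ∨ GenAtom {m ∈ s.M | i ∈ m.grp} a) → a ∈ s.V := by
      rintro a (h | h)
      · exact h.1
      · exact h.sub s.val (fun m hm => s.truthful m hm.1)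
    intro j o
    refine ⟨fun x hx => (s.val j o).1 x (key _ hx), fun a b c h1 h2 => ?_⟩
    by_cases hj : j = i
    · exact Or.inl ⟨(s.val j o).2 a b c (key _ h1) (key _ h2), hj⟩
    · rcases h1 with h1 | h1
      · exact absurd h1.2 hj
      rcases h2 with h2 | h2
      · exact absurd h2.2 hj
      exact Or.inr (GenAtom.step j o a b c h1 h2)
  wf := fun m hm => s.wf m hm.1
  truthful := fun m hm => Or.inr (GenAtom.base m hm)

theorem simI_minSt {n : ℕ} {S : Fin n → Type} {H : Set (Set (Fin n))} (i : Fin n)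
    (s : EpState n S H) : simI i s (minSt i s) := by
  constructor
  · ext a
    constructor
    · rintro ⟨h1, h2⟩
      exact ⟨Or.inl ⟨h1, h2⟩, h2⟩
    · rintro ⟨h1 | h1, h2⟩
      · exact h1
      · exact ⟨h1.sub s.val (fun m hm => s.truthful m hm.1), h2⟩
  · ext m
    constructor
    · rintro ⟨h1, h2⟩
      exact ⟨⟨h1, h2⟩, h2⟩
    · rintro ⟨h1, h2⟩
      exact h1

/-- Componentwise inclusion of states. -/
def stLE {n : ℕ} {S : Fin n → Type} {H : Set (Set (Fin n))} (s t : EpState n S H) : Prop :=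
  s.V ⊆ t.V ∧ s.M ⊆ t.M

theorem minSt_le {n : ℕ} {S : Fin n → Type} {H : Set (Set (Fin n))} {i : Fin n}
    {s t t' : EpState n S H} (h : stLE s t) (ht : simI i t t') : stLE (minSt i s) t' := by
  have hM : ∀ m ∈ s.M, i ∈ m.grp → m ∈ t'.M := fun m hm hi =>
    ((Set.ext_iff.1 ht.2 m).1 ⟨h.2 hm, hi⟩).1
  constructor
  · rintro a (ha | ha)
    · exact ((Set.ext_iff.1 ht.1 a).1 ⟨h.1 ha.1, ha.2⟩).1
    · exact ha.sub t'.val (fun m hm => t'.truthful m (hM m hm.1 hm.2))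
  · rintro m ⟨hm, hi⟩
    exact hM m hm hi

theorem simA_lift {n : ℕ} {S : Fin n → Type} {H : Set (Set (Fin n))} {A : Set (Fin n)}
    {s t t' : EpState n S H} (h : stLE s t) (ht : simA A t t') :
    ∃ s', simA A s s' ∧ stLE s' t' := by
  induction ht with
  | single hr =>
    obtain ⟨i, hi, hr⟩ := hr
    exact ⟨minSt i s, Relation.TransGen.single ⟨i, hi, simI_minSt i s⟩, minSt_le h hr⟩
  | tail _ hr ih =>
    obtain ⟨u, hu, hle⟩ := ih
    obtain ⟨i, hi, hr⟩ := hr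
    exact ⟨minSt i u, Relation.TransGen.tail hu ⟨i, hi, simI_minSt i u⟩, minSt_le hle hr⟩

theorem sat_mono {n : ℕ} {S : Fin n → Type} {H : Set (Set (Fin n))} (φ : Form n S) :
    ∀ {s t : EpState n S H}, stLE s t → sat s φ → sat t φ := by
  induction φ with
  | atom a => exact fun h hs => h.1 hs
  | and f g ihf ihg => exact fun h hs => ⟨ihf h hs.1, ihg h hs.2⟩
  | or f g ihf ihg => exact fun h hs => hs.imp (ihf h) (ihg h)
  | ck A f ih =>
    intro s t h hs t' ht
    obtain ⟨s', hs', hle⟩ := simA_lift h ht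
    exact ih hle (hs s' hs')

theorem sat_minL {n : ℕ} {S : Fin n → Type} {H : Set (Set (Fin n))} (φ : Form n S)
    (l : List (Fin n)) : ∀ s : EpState n S H,
      sat s (l.foldr (fun i acc => Form.ck {i} acc) φ) →
      sat (l.foldl (fun u i => minSt i u) s) φ := by
  induction l with
  | nil => exact fun s h => h
  | cons i l ih =>
    intro s h
    exact ih _ (h (minSt i s) (Relation.TransGen.single ⟨i, rfl, simI_minSt i s⟩))

theorem minL_inv {n : ℕ} {S : Fin n → Type} {H : Set (Set (Fin n))} (s : EpState n S H)
    (i : Fin n) (l : List (Fin n)) (hl : (i :: l).Nodup) :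
    (∀ m ∈ (l.foldl (fun u i => minSt i u) (minSt i s)).M,
      m ∈ s.M ∧ ∀ j ∈ i :: l, j ∈ m.grp) ∧
    (∀ a ∈ (l.foldl (fun u i => minSt i u) (minSt i s)).V,
      GenAtom (l.foldl (fun u i => minSt i u) (minSt i s)).M a ∨ (l = [] ∧ a.pl = i)) := by
  induction l using List.reverseRecOn with
  | nil =>
    constructor
    · rintro m ⟨h1, h2⟩
      exact ⟨h1, by simpa using h2⟩
    · rintro a (h | h)
      · exact Or.inr ⟨rfl, h.2⟩
      · exact Or.inl h
  | append_singleton l k ih =>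
    have hnd : (i :: l).Nodup ∧ k ∉ i :: l := by
      rw [← List.cons_append, List.nodup_append] at hl
      exact ⟨hl.1, fun hk => hl.2.2 k hk k (by simp) rfl⟩
    obtain ⟨ih1, ih2⟩ := ih hnd.1
    rw [List.foldl_append, List.foldl_cons, List.foldl_nil]
    generalize l.foldl (fun u i => minSt i u) (minSt i s) = u at ih1 ih2
    constructor
    · rintro m ⟨h1, h2⟩
      refine ⟨(ih1 m h1).1, fun j hj => ?_⟩
      rw [← List.cons_append, List.mem_append, List.mem_singleton] at hj
      rcases hj with hj | rfl
      · exact (ih1 m h1).2 j hj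
      · exact h2
    · rintro a (⟨h1, h2⟩ | h)
      · left
        rcases ih2 a h1 with h | ⟨_, h⟩
        · have := h.vis u.wf
          rw [h2] at this
          exact this
        · exact absurd (by rw [← h2, h]; simp) hnd.2
      · exact Or.inl h

theorem simA_msgs {n : ℕ} {S : Fin n → Type} {H : Set (Set (Fin n))} {A : Set (Fin n)}
    {s t : EpState n S H} (h : simA A s t) (m : Msg n S) (hm : m ∈ s.M)
    (hA : ∀ j ∈ A, j ∈ m.grp) : m ∈ t.M := by
  induction h with
  | single hr =>
    obtain ⟨i, hi, hr⟩ := hr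
    exact ((Set.ext_iff.1 hr.2 m).1 ⟨hm, hA i hi⟩).1
  | tail _ hr ih =>
    obtain ⟨i, hi, hr⟩ := hr
    exact ((Set.ext_iff.1 hr.2 m).1 ⟨ih, hA i hi⟩).1

theorem sat_ck_forward {n : ℕ} {S : Fin n → Type} {H : Set (Set (Fin n))} {A : Set (Fin n)}
    (hA : A.Nonempty) (φ : Form n S) (l : List (Fin n)) (hl : ∀ j ∈ l, j ∈ A) :
    ∀ s : EpState n S H, sat s (.ck A φ) →
      sat s (l.foldr (fun i acc => Form.ck {i} acc) φ) := by
  induction l with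
  | nil =>
    intro s h
    obtain ⟨i, hi⟩ := hA
    exact h s (Relation.TransGen.single ⟨i, hi, rfl, rfl⟩)
  | cons i l ih =>
    intro s h t ht
    refine ih (fun j hj => hl j (List.mem_cons_of_mem _ hj)) t fun t' ht' => h t' ?_
    refine Relation.TransGen.trans (Relation.TransGen.mono ?_ _ _ ht) ht'
    rintro x y ⟨j, hj, hr⟩
    exact ⟨j, by rw [hj]; exact hl i (by simp), hr⟩

/-- `(V,M) ⊨ C_A φ` iff `(V,M) ⊨ K_{i₁} … K_{i_k} φ` for some ordering
`i₁, …, i_k` of the elements of `A`. -/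
theorem sat_ck_iff_exists_perm {n : ℕ} {S : Fin n → Type}
    (hn : 1 < n) [∀ i, Fintype (S i)] [∀ i, Nonempty (S i)]
    (H : Set (Set (Fin n))) (hH : ∀ A ∈ H, A.Nonempty)
    (st : EpState n S H) (A : Set (Fin n)) (hA : A.Nonempty) (φ : Form n S) :
    sat st (.ck A φ) ↔
      ∃ l : List (Fin n), l.Nodup ∧ (∀ j, j ∈ l ↔ j ∈ A) ∧
        sat st (l.foldr (fun i acc => Form.ck {i} acc) φ) := by
  constructor
  · intro h
    refine ⟨(Finset.univ.filter (· ∈ A)).toList, Finset.nodup_toList _, by simp, ?_⟩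
    exact sat_ck_forward hA φ _ (by simp) st h
  · rintro ⟨l, hnd, hl, h⟩
    cases l with
    | nil =>
      obtain ⟨i, hi⟩ := hA
      exact absurd ((hl i).2 hi) (by simp)
    | cons i l =>
      by_cases hnil : l = []
      · subst hnil
        have hAi : A = {i} := by
          ext j
          rw [← hl j]
          simp
        rw [hAi]
        exact h
      · intro t ht
        obtain ⟨h1, h2⟩ := minL_inv st i l hnd
        have hM : ∀ m ∈ (l.foldl (fun u i => minSt i u) (minSt i st)).M, m ∈ t.M :=
          fun m hm => simA_msgs ht m (h1 m hm).1
            fun j hj => (h1 m hm).2 j ((hl j).2 hj)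
        refine sat_mono φ ⟨fun a ha => ?_, hM⟩ (sat_minL φ (i :: l) st h)
        rcases h2 a ha with hg | hg
        · exact hg.sub t.val (fun m hm => t.truthful m (hM m hm))
        · exact absurd hg.1 hnil
end
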